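/- Let f ∈ F[x] be any polynomial, f_sq its square part and f_no its non-square part. Then for every i ∈ {0,...,2^{m−1}−1}, f_sq(w^{2i}) = f(w^{2i}) and f_no(w^{2i}) = f(w^{2i+1}). -/

import Mathlib

open Polynomial

theorem Polynomial.eval_modByMonic_of_isRoot {R : Type*} [CommRing R] (f q : R[X]) {a : R}
    (h : q.eval a = 0) : (f %ₘ q).eval a = f.eval a := by
  conv_rhs => rw [← modByMonic_add_div f q]
  simp [h]

/-- `f_sq = f %ₘ (X^(2^(m-1)) - 1)` agrees with `f` on the even powers
`w^(2i)` and `f_no = (f %ₘ (X^(2^(m-1)) + 1)).comp (w·X)` takes the values of `f` at the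
odd powers `w^(2i+1)`, for all `i ∈ {0, …, 2^(m-1) - 1}`. -/
theorem stmt_0 {F : Type*} [Field F] (m : ℕ) (hm : 1 ≤ m) (w : F)
    (hw : IsPrimitiveRoot w (2 ^ m)) (f : F[X]) :
    ∀ i < 2 ^ (m - 1),
      (f %ₘ (X ^ 2 ^ (m - 1) - 1)).eval (w ^ (2 * i)) = f.eval (w ^ (2 * i)) ∧
      ((f %ₘ (X ^ 2 ^ (m - 1) + 1)).comp (C w * X)).eval (w ^ (2 * i)) =
        f.eval (w ^ (2 * i + 1)) := by
  intro i _
  have hm' : 2 ^ m = 2 ^ (m - 1) * 2 := by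
    rw [← pow_succ, Nat.sub_add_cancel hm]
  have hneg : w ^ 2 ^ (m - 1) = -1 :=
    (hw.pow (by positivity) hm').eq_neg_one_of_two_right
  have heven : (w ^ (2 * i)) ^ 2 ^ (m - 1) = 1 := by
    rw [pow_right_comm, hneg, pow_mul, neg_one_sq, one_pow]
  constructor
  · apply eval_modByMonic_of_isRoot
    simp [heven]
  · have hodd : (w ^ (2 * i + 1)) ^ 2 ^ (m - 1) = -1 := by
      rw [pow_succ, mul_pow, heven, hneg, one_mul]
    rw [eval_comp, eval_mul, eval_C, eval_X, ← pow_succ']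
    apply eval_modByMonic_of_isRoot
    simp [hodd]
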